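/- Let u be a nonnegative smooth solution of the heat equation Δu = ∂_t u on ℝⁿ × (-∞, 0]. Then for every integer k ≥ 1, ∂_t^k u(x,t) ≥ 0 for all x ∈ ℝⁿ and t ≤ 0; equivalently, for each fixed x the function t ↦ u(x,-t) is completely monotone on (0,∞). -/

import Mathlib

open MeasureTheory Real

noncomputable section

/-- Spatial Laplacian of `f : ℝⁿ → ℝ` at `x` (sum of second partial derivatives). -/
def lap (n : ℕ) (f : EuclideanSpace ℝ (Fin n) → ℝ) (x : EuclideanSpace ℝ (Fin n)) : ℝ :=
  ∑ i : Fin n, fderiv ℝ (fun y => fderiv ℝ f y (EuclideanSpace.single i 1)) x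
    (EuclideanSpace.single i 1)

/-- `u` is a smooth ancient solution of the heat equation on `ℝⁿ × (-∞, 0]`:
it is smooth and satisfies `Δ_x u = ∂_t u` for all `t ≤ 0`. -/
def IsAncientHeat (n : ℕ) (u : EuclideanSpace ℝ (Fin n) × ℝ → ℝ) : Prop :=
  ContDiff ℝ (⊤ : ℕ∞) u ∧ ∀ (x : EuclideanSpace ℝ (Fin n)) (t : ℝ), t ≤ 0 →
    lap n (fun y => u (y, t)) x = deriv (fun s => u (x, s)) t

/-- The derivative of `f` in the constant direction `v`. -/
def dirDeriv {V : Type*} [NormedAddCommGroup V] [NormedSpace ℝ V] (v : V) (f : V → ℝ) : V → ℝ :=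
  fun p => fderiv ℝ f p v

section DirDeriv

variable {V : Type*} [NormedAddCommGroup V] [NormedSpace ℝ V] {f g : V → ℝ}

theorem ContDiff.dirDeriv (hf : ContDiff ℝ (⊤ : ℕ∞) f) (v : V) :
    ContDiff ℝ (⊤ : ℕ∞) (dirDeriv v f) :=
  (hf.fderiv_right (m := (⊤ : ℕ∞)) (by simp)).clm_apply contDiff_const

theorem dirDeriv_add (hf : ContDiff ℝ (⊤ : ℕ∞) f) (hg : ContDiff ℝ (⊤ : ℕ∞) g) (v : V) :
    dirDeriv v (fun p => f p + g p) = fun p => dirDeriv v f p + dirDeriv v g p := by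
  funext p
  simp only [dirDeriv]
  rw [fderiv_fun_add (hf.differentiable (by simp) p) (hg.differentiable (by simp) p)]
  rfl

theorem dirDeriv_sub (hf : ContDiff ℝ (⊤ : ℕ∞) f) (hg : ContDiff ℝ (⊤ : ℕ∞) g) (v : V) :
    dirDeriv v (fun p => f p - g p) = fun p => dirDeriv v f p - dirDeriv v g p := by
  funext p
  simp only [dirDeriv]
  rw [fderiv_fun_sub (hf.differentiable (by simp) p) (hg.differentiable (by simp) p)]
  rfl

theorem dirDeriv_mul (hf : ContDiff ℝ (⊤ : ℕ∞) f) (hg : ContDiff ℝ (⊤ : ℕ∞) g) (v : V) :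
    dirDeriv v (fun p => f p * g p) = fun p => f p * dirDeriv v g p + g p * dirDeriv v f p := by
  funext p
  simp only [dirDeriv]
  rw [fderiv_fun_mul (hf.differentiable (by simp) p) (hg.differentiable (by simp) p)]
  simp

theorem dirDeriv_const (c : ℝ) (v : V) : dirDeriv v (fun _ => c) = fun _ => 0 := by
  funext p
  simp [dirDeriv]

theorem dirDeriv_const_mul (hf : ContDiff ℝ (⊤ : ℕ∞) f) (c : ℝ) (v : V) :
    dirDeriv v (fun p => c * f p) = fun p => c * dirDeriv v f p := by
  rw [dirDeriv_mul contDiff_const hf, dirDeriv_const]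
  simp

theorem dirDeriv_sum {ι : Type*} (s : Finset ι) {F : ι → V → ℝ}
    (hF : ∀ i, ContDiff ℝ (⊤ : ℕ∞) (F i)) (v : V) :
    dirDeriv v (fun p => ∑ i ∈ s, F i p) = fun p => ∑ i ∈ s, dirDeriv v (F i) p := by
  funext p
  simp only [dirDeriv]
  rw [fderiv_fun_sum fun i _ => (hF i).differentiable (by simp) p]
  simp

theorem dirDeriv_comm (hf : ContDiff ℝ (⊤ : ℕ∞) f) (v w : V) :
    dirDeriv v (dirDeriv w f) = dirDeriv w (dirDeriv v f) := by
  funext p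
  have hd : DifferentiableAt ℝ (fderiv ℝ f) p :=
    ((hf.fderiv_right (m := (⊤ : ℕ∞)) (by simp)).differentiable (by simp)) p
  have key : ∀ a b : V, dirDeriv a (dirDeriv b f) p = fderiv ℝ (fderiv ℝ f) p a b := by
    intro a b
    change fderiv ℝ (fun q => fderiv ℝ f q b) p a = _
    rw [fderiv_clm_apply hd (differentiableAt_const b)]
    simp
  rw [key, key]
  exact (hf.contDiffAt.isSymmSndFDerivAt
    (minSmoothness_of_isRCLikeNormedField.trans_le (WithTop.coe_le_coe.2 le_top))).eq v w

theorem hasDerivAt_line (hf : ContDiff ℝ (⊤ : ℕ∞) f) (p v : V) (s : ℝ) :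
    HasDerivAt (fun r : ℝ => f (p + r • v)) (dirDeriv v f (p + s • v)) s := by
  have h1 : HasDerivAt (fun r : ℝ => p + r • v) v s := by
    simpa using ((hasDerivAt_id s).smul_const v).const_add p
  exact ((hf.differentiable (by simp) _).hasFDerivAt).comp_hasDerivAt s h1

theorem dirDeriv_eq_zero_of_isLocalMax (hf : ContDiff ℝ (⊤ : ℕ∞) f) (p v : V)
    (h : IsLocalMax (fun r : ℝ => f (p + r • v)) 0) : dirDeriv v f p = 0 := by
  simpa using h.hasDerivAt_eq_zero (hasDerivAt_line hf p v 0)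

theorem dirDeriv_dirDeriv_nonpos_of_isLocalMax (hf : ContDiff ℝ (⊤ : ℕ∞) f) (p v : V)
    (h : IsLocalMax (fun r : ℝ => f (p + r • v)) 0) : dirDeriv v (dirDeriv v f) p ≤ 0 := by
  by_contra! hpos
  have hd : deriv (fun r : ℝ => f (p + r • v)) = fun r => dirDeriv v f (p + r • v) :=
    funext fun s => (hasDerivAt_line hf p v s).deriv
  have hdd : deriv (deriv (fun r : ℝ => f (p + r • v))) 0 = dirDeriv v (dirDeriv v f) p := by
    rw [hd, (hasDerivAt_line (hf.dirDeriv v) p v 0).deriv]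
    simp
  have hmin : IsLocalMin (fun r : ℝ => f (p + r • v)) 0 := by
    refine isLocalMin_of_deriv_deriv_pos (hdd ▸ hpos) ?_ ?_
    · exact h.deriv_eq_zero
    · exact (hasDerivAt_line hf p v 0).continuousAt
  have hconst : (fun r : ℝ => f (p + r • v)) =ᶠ[nhds 0] fun _ => f (p + (0 : ℝ) • v) := by
    filter_upwards [h, hmin] with r h1 h2 using le_antisymm h1 h2
  have : deriv (deriv (fun r : ℝ => f (p + r • v))) 0 = 0 := by
    rw [hconst.deriv.deriv_eq]
    simp
  linarith

theorem dirDeriv_nonneg_of_left_max (hf : ContDiff ℝ (⊤ : ℕ∞) f) (p v : V)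
    (h : ∀ᶠ r : ℝ in nhdsWithin 0 (Set.Iio 0), f (p + r • v) ≤ f p) : 0 ≤ dirDeriv v f p := by
  have h1 := (hasDerivAt_iff_tendsto_slope.1 (hasDerivAt_line hf p v 0)).mono_left
    (nhdsWithin_mono (0 : ℝ) (fun x (hx : x < 0) => hx.ne) :
      nhdsWithin (0 : ℝ) (Set.Iio 0) ≤ nhdsWithin 0 {0}ᶜ)
  simp only [zero_smul, add_zero] at h1
  refine ge_of_tendsto h1 ?_
  filter_upwards [h, self_mem_nhdsWithin] with r hr hr0
  rw [slope_def_field]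
  simp only [zero_smul, add_zero]
  exact div_nonneg_of_nonpos (by linarith) (by simpa using le_of_lt hr0)

end DirDeriv

section HeatOperator

variable {n : ℕ} {f g : EuclideanSpace ℝ (Fin n) × ℝ → ℝ}

/-- The `i`-th spatial direction in space-time. -/
def spaceDir (i : Fin n) : EuclideanSpace ℝ (Fin n) × ℝ := (EuclideanSpace.single i 1, 0)

/-- The time direction in space-time. -/
def timeDir (n : ℕ) : EuclideanSpace ℝ (Fin n) × ℝ := (0, 1)

/-- The heat operator `∂_t - Δ` on functions on space-time. -/
def heatOp (f : EuclideanSpace ℝ (Fin n) × ℝ → ℝ) (p : EuclideanSpace ℝ (Fin n) × ℝ) : ℝ :=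
  dirDeriv (timeDir n) f p - ∑ i, dirDeriv (spaceDir i) (dirDeriv (spaceDir i) f) p

theorem contDiff_heatOp (hf : ContDiff ℝ (⊤ : ℕ∞) f) : ContDiff ℝ (⊤ : ℕ∞) (heatOp f) :=
  (hf.dirDeriv _).sub (ContDiff.sum fun _ _ => (hf.dirDeriv _).dirDeriv _)

theorem heatOp_sub (hf : ContDiff ℝ (⊤ : ℕ∞) f) (hg : ContDiff ℝ (⊤ : ℕ∞) g)
    (p : EuclideanSpace ℝ (Fin n) × ℝ) :
    heatOp (fun q => f q - g q) p = heatOp f p - heatOp g p := by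
  simp only [heatOp, dirDeriv_sub hf hg, dirDeriv_sub (hf.dirDeriv _) (hg.dirDeriv _),
    Finset.sum_sub_distrib]
  ring

theorem heatOp_const_mul (hf : ContDiff ℝ (⊤ : ℕ∞) f) (c : ℝ)
    (p : EuclideanSpace ℝ (Fin n) × ℝ) :
    heatOp (fun q => c * f q) p = c * heatOp f p := by
  simp only [heatOp, dirDeriv_const_mul hf, dirDeriv_const_mul (hf.dirDeriv _), ← Finset.mul_sum]
  ring

theorem heatOp_sum {ι : Type*} (s : Finset ι) {F : ι → EuclideanSpace ℝ (Fin n) × ℝ → ℝ}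
    (hF : ∀ i, ContDiff ℝ (⊤ : ℕ∞) (F i)) (p : EuclideanSpace ℝ (Fin n) × ℝ) :
    heatOp (fun q => ∑ i ∈ s, F i q) p = ∑ i ∈ s, heatOp (F i) p := by
  simp only [heatOp, dirDeriv_sum s hF, dirDeriv_sum s fun i => (hF i).dirDeriv _,
    Finset.sum_sub_distrib]
  rw [Finset.sum_comm]

theorem heatOp_mul (hf : ContDiff ℝ (⊤ : ℕ∞) f) (hg : ContDiff ℝ (⊤ : ℕ∞) g)
    (p : EuclideanSpace ℝ (Fin n) × ℝ) :
    heatOp (fun q => f q * g q) p = f p * heatOp g p + g p * heatOp f p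
      - 2 * ∑ i, dirDeriv (spaceDir i) f p * dirDeriv (spaceDir i) g p := by
  have h2 : ∀ i : Fin n, dirDeriv (spaceDir i) (dirDeriv (spaceDir i) fun q => f q * g q) p =
      f p * dirDeriv (spaceDir i) (dirDeriv (spaceDir i) g) p
      + g p * dirDeriv (spaceDir i) (dirDeriv (spaceDir i) f) p
      + 2 * (dirDeriv (spaceDir i) f p * dirDeriv (spaceDir i) g p) := by
    intro i
    rw [dirDeriv_mul hf hg, dirDeriv_add (hf.mul (hg.dirDeriv _)) (hg.mul (hf.dirDeriv _)),
      dirDeriv_mul hf (hg.dirDeriv _), dirDeriv_mul hg (hf.dirDeriv _)]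
    ring
  simp only [heatOp, h2]
  simp only [dirDeriv_mul hf hg, Finset.sum_add_distrib, ← Finset.mul_sum]
  ring

theorem heatOp_dirDeriv (hf : ContDiff ℝ (⊤ : ℕ∞) f) (v : EuclideanSpace ℝ (Fin n) × ℝ) :
    heatOp (dirDeriv v f) = dirDeriv v (heatOp f) := by
  funext p
  have h : heatOp f = fun p => dirDeriv (timeDir n) f p
      - ∑ i, dirDeriv (spaceDir i) (dirDeriv (spaceDir i) f) p := rfl
  rw [h, dirDeriv_sub (hf.dirDeriv _) (ContDiff.sum fun _ _ => (hf.dirDeriv _).dirDeriv _),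
    dirDeriv_sum _ fun i => (hf.dirDeriv _).dirDeriv _]
  simp only [heatOp]
  rw [dirDeriv_comm hf]
  congr 1
  refine Finset.sum_congr rfl fun i _ => ?_
  rw [dirDeriv_comm hf (spaceDir i) v, dirDeriv_comm (hf.dirDeriv _) (spaceDir i) v]

theorem dirDeriv_eq_zero_of_past (hf : ContDiff ℝ (⊤ : ℕ∞) f)
    (h : ∀ p : EuclideanSpace ℝ (Fin n) × ℝ, p.2 ≤ 0 → f p = 0)
    (v p : EuclideanSpace ℝ (Fin n) × ℝ) (hp : p.2 ≤ 0) : dirDeriv v f p = 0 := by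
  have hopen : Set.EqOn (dirDeriv v f) (fun _ => 0) (Set.univ ×ˢ Set.Iio 0) := by
    intro q hq
    have hev : f =ᶠ[nhds q] fun _ => 0 := by
      filter_upwards [(isOpen_univ.prod isOpen_Iio).mem_nhds hq] with r hr
      exact h r (le_of_lt hr.2)
    simp [dirDeriv, hev.fderiv_eq]
  have hcl := hopen.closure (hf.dirDeriv v).continuous continuous_const
  refine hcl ?_
  rw [closure_prod_eq, closure_Iio]
  simpa using hp

theorem heatOp_dirDeriv_eq_zero (hf : ContDiff ℝ (⊤ : ℕ∞) f)
    (h : ∀ p : EuclideanSpace ℝ (Fin n) × ℝ, p.2 ≤ 0 → heatOp f p = 0)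
    (v p : EuclideanSpace ℝ (Fin n) × ℝ) (hp : p.2 ≤ 0) : heatOp (dirDeriv v f) p = 0 := by
  rw [heatOp_dirDeriv hf]
  exact dirDeriv_eq_zero_of_past (contDiff_heatOp hf) h v p hp

end HeatOperator

section GradientEstimate

variable {n : ℕ}

theorem sq_trace_le_sum_sq (U : ℝ) (p : Fin n → ℝ) (h : Fin n → Fin n → ℝ) :
    (U * ∑ i, h i i - ∑ i, p i ^ 2) ^ 2 ≤ ((n : ℝ) + 1) *
      (U ^ 2 * ∑ j, ∑ i, h i j ^ 2 - 2 * U * ∑ j, ∑ i, p i * p j * h i j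
        + (∑ i, p i ^ 2) ^ 2) := by
  have e1 : U * ∑ i, h i i - ∑ i, p i ^ 2 = ∑ i, (U * h i i - p i * p i) := by
    rw [Finset.sum_sub_distrib, Finset.mul_sum]
    simp only [sq]
  have e2 : U ^ 2 * ∑ j, ∑ i, h i j ^ 2 - 2 * U * ∑ j, ∑ i, p i * p j * h i j
      + (∑ i, p i ^ 2) ^ 2 = ∑ j, ∑ i, (U * h i j - p i * p j) ^ 2 := by
    rw [sq (∑ i, p i ^ 2), Finset.sum_mul_sum, Finset.mul_sum, Finset.mul_sum,
      ← Finset.sum_sub_distrib, ← Finset.sum_add_distrib]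
    refine Finset.sum_congr rfl fun j _ => ?_
    rw [Finset.mul_sum, Finset.mul_sum, ← Finset.sum_sub_distrib, ← Finset.sum_add_distrib]
    exact Finset.sum_congr rfl fun i _ => by ring
  rw [e1, e2]
  have h1 : (∑ i, (U * h i i - p i * p i)) ^ 2 ≤ (n : ℝ) * ∑ i, (U * h i i - p i * p i) ^ 2 := by
    simpa using sq_sum_le_card_mul_sum_sq (s := Finset.univ) (f := fun i => U * h i i - p i * p i)
  have h2 : ∑ i, (U * h i i - p i * p i) ^ 2 ≤ ∑ j, ∑ i, (U * h i j - p i * p j) ^ 2 :=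
    Finset.sum_le_sum fun j _ => Finset.single_le_sum
      (f := fun i => (U * h i j - p i * p j) ^ 2) (fun i _ => sq_nonneg _) (Finset.mem_univ j)
  have h3 : 0 ≤ ∑ j, ∑ i, (U * h i j - p i * p j) ^ 2 := by positivity
  nlinarith [mul_le_mul_of_nonneg_left h2 (Nat.cast_nonneg (α := ℝ) n)]

/-- The algebra of the Li–Yau argument at a maximum point of the localized quantity. -/
theorem localized_max_le {U φ S L T A B N Q X Y Z W M m K L₀ : ℝ}
    (hU : 0 < U) (hφ : 0 < φ) (hSpos : 0 < S) (hm : 0 < m) (hA : 0 ≤ A) (hK : 0 ≤ K)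
    (hS : S = A - 2 * U * T) (hW : W = 2 * Q - 2 * A * T - 2 * U * B)
    (h1 : φ * W + S * X = 2 * M * U * A) (h2 : φ * Z + S * Y = 2 * M * U * X)
    (hM : M * U ^ 2 = φ * S)
    (h0 : 0 ≤ S * L + φ * (-2 * N + 4 * B) - 2 * Z + 2 * M * A)
    (hH : (U * T - A) ^ 2 ≤ m * (U ^ 2 * N - 2 * U * Q + A ^ 2))
    (hX : X ^ 2 ≤ A * Y) (hY : Y ≤ K * φ) (hL : L ≤ L₀) :
    M ≤ 2 * m * (L₀ + (2 + m) * K) := by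
  have e : φ * U ^ 2 * (S * L + φ * (-2 * N + 4 * B) - 2 * Z + 2 * M * A) =
      U ^ 2 * φ * S * L - 2 * φ ^ 2 * (U ^ 2 * N - 2 * U * Q + A ^ 2)
        - 2 * φ * S * U * X + 2 * S * Y * U ^ 2 := by
    linear_combination (2 * φ ^ 2 * U) * hW - (2 * φ * U) * h1 - 2 * U ^ 2 * h2
      + (-2 * φ * A - 4 * U * X) * hM - 2 * φ ^ 2 * A * hS
  have e0 : 0 ≤ U ^ 2 * φ * S * L - 2 * φ ^ 2 * (U ^ 2 * N - 2 * U * Q + A ^ 2)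
        - 2 * φ * S * U * X + 2 * S * Y * U ^ 2 := by
    rw [← e]; positivity
  have hUT : (U * T - A) ^ 2 = (A + S) ^ 2 / 4 := by rw [hS]; ring
  have hAS : S * (S + 2 * A) ≤ (A + S) ^ 2 := by nlinarith [sq_nonneg A]
  have e1 : S * (S + 2 * A) ≤ 4 * m * (U ^ 2 * N - 2 * U * Q + A ^ 2) := by linarith
  have e2 : 0 ≤ (φ * S) * (2 * m * U ^ 2 * L - φ * (S + 2 * A) - 4 * m * U * X
      + 4 * m * K * U ^ 2) := by
    have t1 : φ ^ 2 * (S * (S + 2 * A)) ≤ φ ^ 2 * (4 * m * (U ^ 2 * N - 2 * U * Q + A ^ 2)) :=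
      mul_le_mul_of_nonneg_left e1 (by positivity)
    have t2 : (4 * m * S * U ^ 2) * Y ≤ (4 * m * S * U ^ 2) * (K * φ) :=
      mul_le_mul_of_nonneg_left hY (by positivity)
    have t3 := mul_nonneg (by positivity : 0 ≤ 2 * m) e0
    linarith
  have e3 := nonneg_of_mul_nonneg_right e2 (by positivity)
  have e4 : -(4 * m * U * X) ≤ 2 * (φ * A) + 2 * m ^ 2 * U ^ 2 * K := by
    have hX2 : X ^ 2 ≤ A * (K * φ) := hX.trans (mul_le_mul_of_nonneg_left hY hA)
    have : |4 * m * U * X| ≤ 2 * (φ * A) + 2 * m ^ 2 * U ^ 2 * K := by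
      refine abs_le_of_sq_le_sq ?_ (by positivity)
      have := mul_le_mul_of_nonneg_left hX2 (by positivity : 0 ≤ 16 * m ^ 2 * U ^ 2)
      nlinarith [sq_nonneg (2 * (φ * A) - 2 * m ^ 2 * U ^ 2 * K)]
    exact (neg_le_abs _).trans this
  have e5 : U ^ 2 * M ≤ U ^ 2 * (2 * m * (L₀ + (2 + m) * K)) := by
    have := mul_le_mul_of_nonneg_left hL (by positivity : 0 ≤ 2 * m * U ^ 2)
    linarith
  exact le_of_mul_le_mul_left e5 (by positivity)

/-- The Li–Yau quantity `|∇u|² - 2 u ∂_t u`. -/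
def liYau (u : EuclideanSpace ℝ (Fin n) × ℝ → ℝ) (p : EuclideanSpace ℝ (Fin n) × ℝ) : ℝ :=
  ∑ j, dirDeriv (spaceDir j) u p * dirDeriv (spaceDir j) u p
    - 2 * (u p * dirDeriv (timeDir n) u p)

variable {u : EuclideanSpace ℝ (Fin n) × ℝ → ℝ}

theorem contDiff_liYau (hu : ContDiff ℝ (⊤ : ℕ∞) u) : ContDiff ℝ (⊤ : ℕ∞) (liYau u) :=
  (ContDiff.sum fun _ _ => (hu.dirDeriv _).mul (hu.dirDeriv _)).sub
    (contDiff_const.mul (hu.mul (hu.dirDeriv _)))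

theorem dirDeriv_liYau (hu : ContDiff ℝ (⊤ : ℕ∞) u) (v p : EuclideanSpace ℝ (Fin n) × ℝ) :
    dirDeriv v (liYau u) p =
      2 * ∑ j, dirDeriv (spaceDir j) u p * dirDeriv v (dirDeriv (spaceDir j) u) p
      - 2 * dirDeriv v u p * dirDeriv (timeDir n) u p
      - 2 * u p * dirDeriv v (dirDeriv (timeDir n) u) p := by
  have h : liYau u = fun p => ∑ j, dirDeriv (spaceDir j) u p * dirDeriv (spaceDir j) u p
    - 2 * (u p * dirDeriv (timeDir n) u p) := rfl
  rw [h, dirDeriv_sub (ContDiff.sum fun _ _ => (hu.dirDeriv _).mul (hu.dirDeriv _))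
    (contDiff_const.mul (hu.mul (hu.dirDeriv _))),
    dirDeriv_sum _ fun _ => (hu.dirDeriv _).mul (hu.dirDeriv _),
    dirDeriv_const_mul (hu.mul (hu.dirDeriv _)), dirDeriv_mul hu (hu.dirDeriv _)]
  simp only [dirDeriv_mul (hu.dirDeriv _) (hu.dirDeriv _), ← two_mul, ← Finset.mul_sum]
  ring

theorem heatOp_liYau (hu : ContDiff ℝ (⊤ : ℕ∞) u)
    (hheat : ∀ p : EuclideanSpace ℝ (Fin n) × ℝ, p.2 ≤ 0 → heatOp u p = 0)
    (p : EuclideanSpace ℝ (Fin n) × ℝ) (hp : p.2 ≤ 0) :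
    heatOp (liYau u) p =
      -2 * ∑ j, ∑ i, dirDeriv (spaceDir i) (dirDeriv (spaceDir j) u) p ^ 2
      + 4 * ∑ i, dirDeriv (spaceDir i) u p *
          dirDeriv (spaceDir i) (dirDeriv (timeDir n) u) p := by
  have h : liYau u = fun p => ∑ j, dirDeriv (spaceDir j) u p * dirDeriv (spaceDir j) u p
    - 2 * (u p * dirDeriv (timeDir n) u p) := rfl
  rw [h, heatOp_sub (ContDiff.sum fun _ _ => (hu.dirDeriv _).mul (hu.dirDeriv _))
    (contDiff_const.mul (hu.mul (hu.dirDeriv _))),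
    heatOp_sum _ fun _ => (hu.dirDeriv _).mul (hu.dirDeriv _),
    heatOp_const_mul (hu.mul (hu.dirDeriv _)), heatOp_mul hu (hu.dirDeriv _)]
  simp only [heatOp_mul (hu.dirDeriv _) (hu.dirDeriv _),
    heatOp_dirDeriv_eq_zero hu hheat _ p hp, hheat p hp]
  simp only [mul_zero, add_zero, zero_sub, Finset.sum_neg_distrib, ← Finset.mul_sum, sq]
  ring

end GradientEstimate

section Localization

variable {n : ℕ} {u : EuclideanSpace ℝ (Fin n) × ℝ → ℝ}

/-- The function `R² - |x - x₀|²`, positive exactly on the ball of radius `R`. -/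
def ballFn (x₀ : EuclideanSpace ℝ (Fin n)) (R : ℝ) (p : EuclideanSpace ℝ (Fin n) × ℝ) : ℝ :=
  R ^ 2 - ∑ j, (p.1 j - x₀ j) * (p.1 j - x₀ j)

theorem contDiff_coord_sub (x₀ : EuclideanSpace ℝ (Fin n)) (j : Fin n) :
    ContDiff ℝ (⊤ : ℕ∞) fun p : EuclideanSpace ℝ (Fin n) × ℝ => p.1 j - x₀ j := by
  fun_prop

theorem dirDeriv_coord_sub (x₀ : EuclideanSpace ℝ (Fin n)) (j : Fin n)
    (v : EuclideanSpace ℝ (Fin n) × ℝ) :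
    dirDeriv v (fun p : EuclideanSpace ℝ (Fin n) × ℝ => p.1 j - x₀ j) = fun _ => v.1 j := by
  funext p
  have h : HasFDerivAt (fun p : EuclideanSpace ℝ (Fin n) × ℝ => p.1 j - x₀ j)
      ((EuclideanSpace.proj j : EuclideanSpace ℝ (Fin n) →L[ℝ] ℝ).comp
        (ContinuousLinearMap.fst ℝ (EuclideanSpace ℝ (Fin n)) ℝ)) p :=
    ((EuclideanSpace.proj j : EuclideanSpace ℝ (Fin n) →L[ℝ] ℝ).comp
      (ContinuousLinearMap.fst ℝ (EuclideanSpace ℝ (Fin n)) ℝ)).hasFDerivAt.sub_const (x₀ j)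
  simp [dirDeriv, h.fderiv]

theorem contDiff_snd_sub (c : ℝ) :
    ContDiff ℝ (⊤ : ℕ∞) fun p : EuclideanSpace ℝ (Fin n) × ℝ => p.2 - c := by
  fun_prop

theorem dirDeriv_snd_sub (c : ℝ) (v : EuclideanSpace ℝ (Fin n) × ℝ) :
    dirDeriv v (fun p : EuclideanSpace ℝ (Fin n) × ℝ => p.2 - c) = fun _ => v.2 := by
  funext p
  have h : HasFDerivAt (fun p : EuclideanSpace ℝ (Fin n) × ℝ => p.2 - c)
      (ContinuousLinearMap.snd ℝ (EuclideanSpace ℝ (Fin n)) ℝ) p :=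
    hasFDerivAt_snd.sub_const c
  simp [dirDeriv, h.fderiv]

theorem contDiff_ballFn (x₀ : EuclideanSpace ℝ (Fin n)) (R : ℝ) :
    ContDiff ℝ (⊤ : ℕ∞) (ballFn x₀ R) :=
  contDiff_const.sub
    (ContDiff.sum fun j _ => (contDiff_coord_sub x₀ j).mul (contDiff_coord_sub x₀ j))

theorem dirDeriv_ballFn (x₀ : EuclideanSpace ℝ (Fin n)) (R : ℝ)
    (v : EuclideanSpace ℝ (Fin n) × ℝ) :
    dirDeriv v (ballFn x₀ R) = fun p => -2 * ∑ j, (p.1 j - x₀ j) * v.1 j := by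
  have h : ballFn x₀ R = fun p => R ^ 2 - ∑ j, (p.1 j - x₀ j) * (p.1 j - x₀ j) := rfl
  have hc := fun j => (contDiff_coord_sub x₀ j).mul (contDiff_coord_sub x₀ j)
  rw [h, dirDeriv_sub contDiff_const (ContDiff.sum fun j _ => hc j), dirDeriv_const,
    dirDeriv_sum _ hc]
  simp only [dirDeriv_mul (contDiff_coord_sub x₀ _) (contDiff_coord_sub x₀ _),
    dirDeriv_coord_sub, ← two_mul, ← Finset.mul_sum]
  funext p
  ring

theorem dirDeriv_spaceDir_ballFn (x₀ : EuclideanSpace ℝ (Fin n)) (R : ℝ) (i : Fin n) :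
    dirDeriv (spaceDir i) (ballFn x₀ R) = fun p => -2 * (p.1 i - x₀ i) := by
  rw [dirDeriv_ballFn]
  simp [spaceDir]

theorem heatOp_ballFn (x₀ : EuclideanSpace ℝ (Fin n)) (R : ℝ)
    (p : EuclideanSpace ℝ (Fin n) × ℝ) : heatOp (ballFn x₀ R) p = 2 * n := by
  simp only [heatOp, dirDeriv_spaceDir_ballFn, dirDeriv_const_mul (contDiff_coord_sub x₀ _),
    dirDeriv_coord_sub]
  simp [dirDeriv_ballFn, timeDir, spaceDir]
  ring

theorem ballFn_nonneg_iff {x₀ : EuclideanSpace ℝ (Fin n)} {R : ℝ} (hR : 0 ≤ R)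
    (p : EuclideanSpace ℝ (Fin n) × ℝ) :
    0 ≤ ballFn x₀ R p ↔ p.1 ∈ Metric.closedBall x₀ R := by
  rw [mem_closedBall_iff_norm, ← sq_le_sq₀ (norm_nonneg _) hR, EuclideanSpace.norm_sq_eq]
  simp [ballFn, ← sq]

/-- A cutoff function for the parabolic cylinder of radius `R` with top centre `(x₀, t₀)`. -/
def cutoff (x₀ : EuclideanSpace ℝ (Fin n)) (t₀ R : ℝ) (p : EuclideanSpace ℝ (Fin n) × ℝ) : ℝ :=
  ballFn x₀ R p * ballFn x₀ R p * (p.2 - (t₀ - R ^ 2))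

theorem contDiff_cutoff (x₀ : EuclideanSpace ℝ (Fin n)) (t₀ R : ℝ) :
    ContDiff ℝ (⊤ : ℕ∞) (cutoff x₀ t₀ R) :=
  ((contDiff_ballFn x₀ R).mul (contDiff_ballFn x₀ R)).mul (contDiff_snd_sub _)

theorem dirDeriv_spaceDir_cutoff (x₀ : EuclideanSpace ℝ (Fin n)) (t₀ R : ℝ) (i : Fin n)
    (p : EuclideanSpace ℝ (Fin n) × ℝ) :
    dirDeriv (spaceDir i) (cutoff x₀ t₀ R) p =
      -4 * (p.2 - (t₀ - R ^ 2)) * ballFn x₀ R p * (p.1 i - x₀ i) := by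
  have h : cutoff x₀ t₀ R =
    fun p => ballFn x₀ R p * ballFn x₀ R p * (p.2 - (t₀ - R ^ 2)) := rfl
  have ha := contDiff_ballFn x₀ R
  rw [h, dirDeriv_mul (ha.mul ha) (contDiff_snd_sub _), dirDeriv_mul ha ha,
    dirDeriv_spaceDir_ballFn, dirDeriv_snd_sub]
  simp only [spaceDir]
  ring

theorem heatOp_cutoff (x₀ : EuclideanSpace ℝ (Fin n)) (t₀ R : ℝ)
    (p : EuclideanSpace ℝ (Fin n) × ℝ) :
    heatOp (cutoff x₀ t₀ R) p = ballFn x₀ R p ^ 2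
      + 4 * n * ballFn x₀ R p * (p.2 - (t₀ - R ^ 2))
      - 8 * (p.2 - (t₀ - R ^ 2)) * ∑ j, (p.1 j - x₀ j) * (p.1 j - x₀ j) := by
  have h : cutoff x₀ t₀ R =
    fun p => ballFn x₀ R p * ballFn x₀ R p * (p.2 - (t₀ - R ^ 2)) := rfl
  have ha := contDiff_ballFn x₀ R
  have hb : heatOp (fun p : EuclideanSpace ℝ (Fin n) × ℝ => p.2 - (t₀ - R ^ 2)) p = 1 := by
    simp [heatOp, dirDeriv_snd_sub, dirDeriv_const, timeDir]
  have hs : ∀ j, -2 * (p.1 j - x₀ j) * (-2 * (p.1 j - x₀ j)) =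
      4 * ((p.1 j - x₀ j) * (p.1 j - x₀ j)) := fun j => by ring
  rw [h, heatOp_mul (ha.mul ha) (contDiff_snd_sub _), heatOp_mul ha ha, heatOp_ballFn, hb]
  simp only [dirDeriv_spaceDir_ballFn, dirDeriv_snd_sub, hs, ← Finset.mul_sum]
  simp [spaceDir]
  ring

theorem heatOp_nonneg_of_max {Z : EuclideanSpace ℝ (Fin n) × ℝ → ℝ}
    (hZ : ContDiff ℝ (⊤ : ℕ∞) Z) (p : EuclideanSpace ℝ (Fin n) × ℝ)
    (hmax : ∀ᶠ q in nhds p, q.2 ≤ p.2 → Z q ≤ Z p) :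
    (∀ i, dirDeriv (spaceDir i) Z p = 0) ∧ 0 ≤ heatOp Z p := by
  have hline : ∀ v : EuclideanSpace ℝ (Fin n) × ℝ,
      Filter.Tendsto (fun r : ℝ => p + r • v) (nhds 0) (nhds p) := by
    intro v
    have : Continuous fun r : ℝ => p + r • v := by fun_prop
    simpa using this.tendsto 0
  have hloc : ∀ i, IsLocalMax (fun r : ℝ => Z (p + r • spaceDir i)) 0 := by
    intro i
    filter_upwards [(hline (spaceDir i)).eventually hmax] with r hr
    simpa [spaceDir] using hr
  have htime : 0 ≤ dirDeriv (timeDir n) Z p := by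
    refine dirDeriv_nonneg_of_left_max hZ p _ ?_
    filter_upwards [((hline (timeDir n)).mono_left nhdsWithin_le_nhds).eventually hmax,
      self_mem_nhdsWithin] with r hr hr0
    exact hr (by simpa [timeDir] using le_of_lt hr0)
  refine ⟨fun i => dirDeriv_eq_zero_of_isLocalMax hZ p _ (hloc i), ?_⟩
  have := Finset.sum_nonpos fun i (_ : i ∈ Finset.univ) =>
    dirDeriv_dirDeriv_nonpos_of_isLocalMax hZ p (spaceDir i) (hloc i)
  simp only [heatOp]
  linarith

theorem cutoff_mul_liYau_le_at_max (hu : ContDiff ℝ (⊤ : ℕ∞) u)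
    (hheat : ∀ p : EuclideanSpace ℝ (Fin n) × ℝ, p.2 ≤ 0 → heatOp u p = 0)
    (x₀ : EuclideanSpace ℝ (Fin n)) {t₀ R M : ℝ} (p : EuclideanSpace ℝ (Fin n) × ℝ)
    (hp : p.2 ≤ 0) (hup : 0 < u p) (hpt : p.2 ≤ t₀)
    (ha : 0 < ballFn x₀ R p) (hb : 0 < p.2 - (t₀ - R ^ 2)) (hS : 0 < liYau u p)
    (hM : M * u p ^ 2 = cutoff x₀ t₀ R p * liYau u p)
    (hmax : ∀ᶠ q in nhds p, q.2 ≤ p.2 →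
      cutoff x₀ t₀ R q * liYau u q - M * (u q * u q) ≤
        cutoff x₀ t₀ R p * liYau u p - M * (u p * u p)) :
    M ≤ 2 * (n + 1) * ((1 + 4 * n) * R ^ 4 + (2 + (n + 1)) * (16 * R ^ 4)) := by
  have hφ : 0 < cutoff x₀ t₀ R p := mul_pos (mul_pos ha ha) hb
  have hcφ := contDiff_cutoff x₀ t₀ R
  have hcS := contDiff_liYau hu
  have huu := hu.mul hu
  obtain ⟨hgrad, hheatZ⟩ := heatOp_nonneg_of_max
    ((hcφ.mul hcS).sub (contDiff_const.mul huu)) p hmax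
  have hgrad' : ∀ i, cutoff x₀ t₀ R p * dirDeriv (spaceDir i) (liYau u) p
      + liYau u p * dirDeriv (spaceDir i) (cutoff x₀ t₀ R) p
      = 2 * M * u p * dirDeriv (spaceDir i) u p := by
    intro i
    have := hgrad i
    rw [dirDeriv_sub (hcφ.mul hcS) (contDiff_const.mul huu), dirDeriv_mul hcφ hcS,
      dirDeriv_const_mul huu, dirDeriv_mul hu hu] at this
    linarith
  rw [heatOp_sub (hcφ.mul hcS) (contDiff_const.mul huu), heatOp_mul hcφ hcS,
    heatOp_const_mul huu, heatOp_mul hu hu, hheat p hp, heatOp_liYau hu hheat p hp] at hheatZ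
  have hT : dirDeriv (timeDir n) u p =
      ∑ i, dirDeriv (spaceDir i) (dirDeriv (spaceDir i) u) p := by
    have := hheat p hp
    simp only [heatOp] at this
    linarith
  have hsum : ∑ j, (p.1 j - x₀ j) * (p.1 j - x₀ j) = R ^ 2 - ballFn x₀ R p := by
    simp [ballFn]
  have hr : 0 ≤ ∑ j, (p.1 j - x₀ j) * (p.1 j - x₀ j) :=
    Finset.sum_nonneg fun j _ => mul_self_nonneg _
  have hbR : p.2 - (t₀ - R ^ 2) ≤ R ^ 2 := by linarith
  have haR : ballFn x₀ R p ≤ R ^ 2 := by linarith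
  refine localized_max_le (U := u p) (φ := cutoff x₀ t₀ R p) (S := liYau u p)
    (L := heatOp (cutoff x₀ t₀ R) p) (T := dirDeriv (timeDir n) u p)
    (A := ∑ i, dirDeriv (spaceDir i) u p ^ 2)
    (B := ∑ i, dirDeriv (spaceDir i) u p * dirDeriv (spaceDir i) (dirDeriv (timeDir n) u) p)
    (N := ∑ j, ∑ i, dirDeriv (spaceDir i) (dirDeriv (spaceDir j) u) p ^ 2)
    (Q := ∑ j, ∑ i, dirDeriv (spaceDir i) u p * dirDeriv (spaceDir j) u p *
      dirDeriv (spaceDir i) (dirDeriv (spaceDir j) u) p)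
    (X := ∑ i, dirDeriv (spaceDir i) u p * dirDeriv (spaceDir i) (cutoff x₀ t₀ R) p)
    (Y := ∑ i, dirDeriv (spaceDir i) (cutoff x₀ t₀ R) p ^ 2)
    (Z := ∑ i, dirDeriv (spaceDir i) (cutoff x₀ t₀ R) p * dirDeriv (spaceDir i) (liYau u) p)
    (W := ∑ i, dirDeriv (spaceDir i) u p * dirDeriv (spaceDir i) (liYau u) p)
    hup hφ hS (by positivity) (by positivity) (by positivity) ?_ ?_ ?_ ?_ hM ?_ ?_ ?_ ?_ ?_
  · simp only [liYau, sq]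
    ring
  · simp only [dirDeriv_liYau hu]
    rw [Finset.sum_comm]
    simp only [Finset.mul_sum, Finset.sum_mul, ← Finset.sum_sub_distrib]
    refine Finset.sum_congr rfl fun i _ => ?_
    rw [mul_sub, mul_sub, Finset.mul_sum]
    congr 1
    · congr 1
      · exact Finset.sum_congr rfl fun j _ => by ring
      · ring
    · ring
  · simp only [Finset.mul_sum, ← Finset.sum_add_distrib]
    exact Finset.sum_congr rfl fun i _ => by
      linear_combination dirDeriv (spaceDir i) u p * hgrad' i
  · simp only [Finset.mul_sum, ← Finset.sum_add_distrib]
    exact Finset.sum_congr rfl fun i _ => by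
      linear_combination dirDeriv (spaceDir i) (cutoff x₀ t₀ R) p * hgrad' i
  · simp only [sq] at hheatZ ⊢
    linarith
  · rw [hT]
    exact sq_trace_le_sum_sq (u p) (fun i => dirDeriv (spaceDir i) u p)
      fun i j => dirDeriv (spaceDir i) (dirDeriv (spaceDir j) u) p
  · exact Finset.sum_mul_sq_le_sq_mul_sq _ _ _
  · simp only [dirDeriv_spaceDir_cutoff, mul_pow _ _ 2, ← Finset.mul_sum]
    simp only [sq (p.1 _ - x₀ _), cutoff]
    have h1 : (p.2 - (t₀ - R ^ 2)) * ∑ j, (p.1 j - x₀ j) * (p.1 j - x₀ j) ≤ R ^ 2 * R ^ 2 :=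
      mul_le_mul hbR (by linarith) hr (by positivity)
    have := mul_le_mul_of_nonneg_left h1 hφ.le
    simp only [cutoff] at this
    linarith
  · rw [heatOp_cutoff]
    have h1 : ballFn x₀ R p ^ 2 ≤ R ^ 2 * R ^ 2 := by
      rw [sq]; exact mul_le_mul haR haR ha.le (by positivity)
    have h2 : 4 * (n : ℝ) * (ballFn x₀ R p * (p.2 - (t₀ - R ^ 2))) ≤ 4 * n * (R ^ 2 * R ^ 2) :=
      mul_le_mul_of_nonneg_left (mul_le_mul haR hbR hb.le (by positivity)) (by positivity)
    have h3 := mul_nonneg hb.le hr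
    linarith

theorem sq_mul_liYau_le (hu : ContDiff ℝ (⊤ : ℕ∞) u)
    (hheat : ∀ p : EuclideanSpace ℝ (Fin n) × ℝ, p.2 ≤ 0 → heatOp u p = 0)
    (hpos : ∀ p : EuclideanSpace ℝ (Fin n) × ℝ, p.2 ≤ 0 → 0 < u p)
    (x₀ : EuclideanSpace ℝ (Fin n)) {t₀ R : ℝ} (ht₀ : t₀ ≤ 0) (hR : 0 < R) :
    R ^ 2 * liYau u (x₀, t₀) ≤
      2 * (n + 1) * ((1 + 4 * n) + (2 + (n + 1)) * 16) * u (x₀, t₀) ^ 2 := by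
  set c : ℝ := 2 * (n + 1) * ((1 + 4 * n) + (2 + (n + 1)) * 16) with hc
  have hc0 : 0 ≤ c := by positivity
  let K : Set (EuclideanSpace ℝ (Fin n) × ℝ) :=
    Metric.closedBall x₀ R ×ˢ Set.Icc (t₀ - R ^ 2) t₀
  have hKc : IsCompact K := (isCompact_closedBall x₀ R).prod isCompact_Icc
  have hcen : (x₀, t₀) ∈ K := ⟨by simpa using hR.le, by simp; positivity⟩
  have hcont : ContinuousOn (fun q => cutoff x₀ t₀ R q * liYau u q / u q ^ 2) K := by
    refine ContinuousOn.div ?_ (hu.continuous.pow 2).continuousOn fun q hq => ?_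
    · exact ((contDiff_cutoff x₀ t₀ R).continuous.mul (contDiff_liYau hu).continuous).continuousOn
    · exact (pow_pos (hpos q (hq.2.2.trans ht₀)) 2).ne'
  obtain ⟨p, hpK, hpmax⟩ := hKc.exists_isMaxOn ⟨_, hcen⟩ hcont
  have hp0 : p.2 ≤ 0 := hpK.2.2.trans ht₀
  have hup := hpos p hp0
  set M := cutoff x₀ t₀ R p * liYau u p / u p ^ 2
  have hM : M * u p ^ 2 = cutoff x₀ t₀ R p * liYau u p :=
    div_mul_cancel₀ _ (pow_pos hup 2).ne'
  have hle : ∀ q ∈ K, cutoff x₀ t₀ R q * liYau u q ≤ M * u q ^ 2 := fun q hq =>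
    (div_le_iff₀ (pow_pos (hpos q (hq.2.2.trans ht₀)) 2)).1 (hpmax hq)
  have hMle : M ≤ c * R ^ 4 := by
    rcases le_or_gt M 0 with hM0 | hM0
    · exact hM0.trans (by positivity)
    have hprod : 0 < cutoff x₀ t₀ R p * liYau u p := hM ▸ mul_pos hM0 (pow_pos hup 2)
    have ha0 : 0 ≤ ballFn x₀ R p := (ballFn_nonneg_iff hR.le p).2 hpK.1
    have hb0 : 0 ≤ p.2 - (t₀ - R ^ 2) := sub_nonneg.2 hpK.2.1
    have hne : cutoff x₀ t₀ R p ≠ 0 := left_ne_zero_of_mul hprod.ne'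
    have ha : 0 < ballFn x₀ R p := lt_of_le_of_ne ha0 fun h => hne (by simp [cutoff, ← h])
    have hb : 0 < p.2 - (t₀ - R ^ 2) := lt_of_le_of_ne hb0 fun h => hne (by simp [cutoff, ← h])
    have hS : 0 < liYau u p := pos_of_mul_pos_right hprod (mul_pos (mul_pos ha ha) hb).le
    have := cutoff_mul_liYau_le_at_max hu hheat x₀ p hp0 hup hpK.2.2 ha hb hS hM (by
      filter_upwards [(contDiff_ballFn x₀ R).continuous.continuousAt.eventually (lt_mem_nhds ha),
        (contDiff_snd_sub (t₀ - R ^ 2)).continuous.continuousAt.eventually (lt_mem_nhds hb)]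
        with q hqa hqb hq
      have := hle q ⟨(ballFn_nonneg_iff hR.le q).1 hqa.le, by linarith, hq.trans hpK.2.2⟩
      linarith)
    rw [hc]
    linarith
  have h1 := (hle _ hcen).trans (mul_le_mul_of_nonneg_right hMle (sq_nonneg _))
  have h2 : cutoff x₀ t₀ R (x₀, t₀) = R ^ 4 * R ^ 2 := by
    have : ballFn x₀ R (x₀, t₀) = R ^ 2 := by simp [ballFn]
    rw [cutoff, this]
    ring
  rw [h2] at h1
  refine le_of_mul_le_mul_left ?_ (pow_pos hR 4)
  linarith

theorem liYau_nonpos (hu : ContDiff ℝ (⊤ : ℕ∞) u)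
    (hheat : ∀ p : EuclideanSpace ℝ (Fin n) × ℝ, p.2 ≤ 0 → heatOp u p = 0)
    (hpos : ∀ p : EuclideanSpace ℝ (Fin n) × ℝ, p.2 ≤ 0 → 0 < u p)
    (p : EuclideanSpace ℝ (Fin n) × ℝ) (hp : p.2 ≤ 0) : liYau u p ≤ 0 := by
  by_contra! hS
  set C := 2 * ((n : ℝ) + 1) * ((1 + 4 * n) + (2 + (n + 1)) * 16) * u p ^ 2
  have hC : 0 ≤ C := by positivity
  have h := sq_mul_liYau_le hu hheat hpos p.1 (R := √((C + 1) / liYau u p)) hp (by positivity)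
  rw [Real.sq_sqrt (by positivity), div_mul_cancel₀ _ hS.ne'] at h
  linarith

theorem dirDeriv_timeDir_nonneg (hu : ContDiff ℝ (⊤ : ℕ∞) u)
    (hheat : ∀ p : EuclideanSpace ℝ (Fin n) × ℝ, p.2 ≤ 0 → heatOp u p = 0)
    (hnonneg : ∀ p : EuclideanSpace ℝ (Fin n) × ℝ, p.2 ≤ 0 → 0 ≤ u p)
    (p : EuclideanSpace ℝ (Fin n) × ℝ) (hp : p.2 ≤ 0) : 0 ≤ dirDeriv (timeDir n) u p := by
  have hD : ∀ v, dirDeriv v (fun q => u q + 1) = dirDeriv v u := fun v => by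
    simp [dirDeriv_add hu contDiff_const, dirDeriv_const]
  have h := liYau_nonpos (u := fun q => u q + 1) (hu.add contDiff_const)
    (fun q hq => by simpa only [heatOp, hD] using hheat q hq)
    (fun q hq => by linarith [hnonneg q hq]) p hp
  simp only [liYau, hD] at h
  have hsum : 0 ≤ ∑ j, dirDeriv (spaceDir j) u p * dirDeriv (spaceDir j) u p :=
    Finset.sum_nonneg fun j _ => mul_self_nonneg _
  refine nonneg_of_mul_nonneg_right (a := u p + 1) (by linarith) ?_
  linarith [hnonneg p hp]

theorem iterate_dirDeriv_timeDir_nonneg (k : ℕ) (hu : ContDiff ℝ (⊤ : ℕ∞) u)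
    (hheat : ∀ p : EuclideanSpace ℝ (Fin n) × ℝ, p.2 ≤ 0 → heatOp u p = 0)
    (hnonneg : ∀ p : EuclideanSpace ℝ (Fin n) × ℝ, p.2 ≤ 0 → 0 ≤ u p)
    (p : EuclideanSpace ℝ (Fin n) × ℝ) (hp : p.2 ≤ 0) :
    0 ≤ (dirDeriv (timeDir n))^[k] u p := by
  induction k generalizing u with
  | zero => exact hnonneg p hp
  | succ k ih =>
    exact ih (hu.dirDeriv _) (heatOp_dirDeriv_eq_zero hu hheat _)
      (dirDeriv_timeDir_nonneg hu hheat hnonneg)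

theorem deriv_time_eq_dirDeriv (hu : ContDiff ℝ (⊤ : ℕ∞) u) (x : EuclideanSpace ℝ (Fin n)) :
    deriv (fun s => u (x, s)) = fun s => dirDeriv (timeDir n) u (x, s) := by
  funext s
  simpa [timeDir] using (hasDerivAt_line hu (x, 0) (timeDir n) s).deriv

theorem iteratedDeriv_time_eq (k : ℕ) (hu : ContDiff ℝ (⊤ : ℕ∞) u)
    (x : EuclideanSpace ℝ (Fin n)) :
    iteratedDeriv k (fun s => u (x, s)) = fun s => (dirDeriv (timeDir n))^[k] u (x, s) := by
  induction k generalizing u with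
  | zero => simp
  | succ k ih =>
    rw [iteratedDeriv_succ', deriv_time_eq_dirDeriv hu, ih (hu.dirDeriv _)]
    rfl

theorem fderiv_slice_eq_dirDeriv (hu : ContDiff ℝ (⊤ : ℕ∞) u) (x : EuclideanSpace ℝ (Fin n))
    (t : ℝ) (i : Fin n) :
    fderiv ℝ (fun y => u (y, t)) x (EuclideanSpace.single i 1) =
      dirDeriv (spaceDir i) u (x, t) := by
  have h := HasFDerivAt.comp (f := fun y => (y, t)) x
    (hu.differentiable (by simp) (x, t)).hasFDerivAt (hasFDerivAt_prodMk_left x t)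
  have h' : fderiv ℝ (fun y => u (y, t)) x = _ := h.fderiv
  rw [h']
  simp [dirDeriv, spaceDir]

theorem IsAncientHeat.heatOp_eq_zero (hu : IsAncientHeat n u)
    (p : EuclideanSpace ℝ (Fin n) × ℝ) (hp : p.2 ≤ 0) : heatOp u p = 0 := by
  have h := hu.2 p.1 p.2 hp
  simp only [lap, fderiv_slice_eq_dirDeriv hu.1] at h
  simp only [fderiv_slice_eq_dirDeriv (hu.1.dirDeriv _), deriv_time_eq_dirDeriv hu.1] at h
  simp only [heatOp, h, sub_self]

end Localization

/-- for a nonnegative ancient solution of the heat equation on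
`ℝⁿ × (-∞, 0]`, all time derivatives `∂_t^k u` (k ≥ 1) are nonnegative for `t ≤ 0`;
equivalently, for each fixed `x` the function `t ↦ u(x, -t)` is completely monotone
on `(0, ∞)`. -/
theorem ancient_nonneg_heat_completely_monotone (n : ℕ)
    (u : EuclideanSpace ℝ (Fin n) × ℝ → ℝ)
    (hu : IsAncientHeat n u)
    (hnonneg : ∀ (x : EuclideanSpace ℝ (Fin n)) (t : ℝ), t ≤ 0 → 0 ≤ u (x, t)) :
    (∀ k : ℕ, 1 ≤ k → ∀ (x : EuclideanSpace ℝ (Fin n)) (t : ℝ), t ≤ 0 →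
      0 ≤ iteratedDeriv k (fun s => u (x, s)) t) ∧
    (∀ (x : EuclideanSpace ℝ (Fin n)) (k : ℕ) (t : ℝ), 0 < t →
      0 ≤ (-1 : ℝ) ^ k * iteratedDeriv k (fun s => u (x, -s)) t) := by
  have key : ∀ (k : ℕ) (x : EuclideanSpace ℝ (Fin n)) (t : ℝ), t ≤ 0 →
      0 ≤ iteratedDeriv k (fun s => u (x, s)) t := by
    intro k x t ht
    rw [iteratedDeriv_time_eq k hu.1]
    exact iterate_dirDeriv_timeDir_nonneg k hu.1 hu.heatOp_eq_zero
      (fun p hp => hnonneg p.1 p.2 hp) (x, t) ht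
  refine ⟨fun k _ => key k, fun x k t ht => ?_⟩
  rw [iteratedDeriv_comp_neg k (fun s => u (x, s)) t, smul_eq_mul, ← mul_assoc, ← mul_pow]
  simpa using key k x (-t) (by linarith)
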